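/- (Interval theorem, tangent-map version.) Let G act on ℂ^D with ℂ^D an irreducible G-module, and let V, V' ⊆ ℂ^D be irreducible Zariski-closed G-invariant cones with V ≠ {0} and V' ≠ {0}. Let O ⊆ V and O' ⊆ V' be dense open subsets and N, N' : ℕ with N' ≥ 1 such that finrank (T_x V) = N for all x ∈ O and finrank (T_y V') = N' for all y ∈ O'. For m ≥ 1 let P m be the proposition that the set {((x₁,…,x_m), y) ∈ O^m × O' : (T_{x₁}V ⊔ ⋯ ⊔ T_{x_m}V) ⊓ T_y V' = ⊥} is dense in V^m × V', and let P 0 := True; let Q m be the proposition that there exist x₁, …, x_m ∈ O with T_{x₁}V ⊔ ⋯ ⊔ T_{x_m}V = ℂ^D. Then the set {m : ¬ P m ∧ ¬ Q m} is finite and has at most N' elements. -/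

import Mathlib

/-!
STATEMENT 4: the interval theorem, tangent-map version: the set of `m` for which
neither the generic intersection is trivial nor `m` generic tangent spaces fill `ℂ^D`
is finite with at most `N'` elements.
-/

noncomputable section

/-- The Zariski topology on `ι → ℂ`: a set is closed iff it is the common zero locus
of a family of polynomials in `MvPolynomial ι ℂ`. -/
def zt (ι : Type*) : TopologicalSpace (ι → ℂ) :=
  TopologicalSpace.generateFrom
    { U | ∃ f : MvPolynomial ι ℂ, U = { x | MvPolynomial.eval x f ≠ 0 } }

def zIsClosed {ι : Type*} (S : Set (ι → ℂ)) : Prop := @IsClosed _ (zt ι) S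

def zIsOpen {ι : Type*} (S : Set (ι → ℂ)) : Prop := @IsOpen _ (zt ι) S

def zIsIrreducible {ι : Type*} (S : Set (ι → ℂ)) : Prop := @IsIrreducible _ (zt ι) S

def zClosure {ι : Type*} (S : Set (ι → ℂ)) : Set (ι → ℂ) := @closure _ (zt ι) S

/-- `O` is a dense open subset of `S` (for the subspace topology on `S`). -/
def IsDenseOpenSubset {ι : Type*} (O S : Set (ι → ℂ)) : Prop :=
  O ⊆ S ∧ (∃ U, zIsOpen U ∧ O = U ∩ S) ∧ S ⊆ zClosure O

/-- `ℂ^D` is an irreducible `G`-module (through `ρ`). -/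
def IsIrreducibleGModule {D : ℕ} {G : Type*} [Group G]
    (ρ : G →* ((Fin D → ℂ) ≃ₗ[ℂ] (Fin D → ℂ))) : Prop :=
  1 ≤ D ∧ ∀ W : Submodule ℂ (Fin D → ℂ),
    (∀ g : G, ∀ x ∈ W, ρ g x ∈ W) → W = ⊥ ∨ W = ⊤

/-- The embedded tangent space to `V ⊆ ℂ^D` at `x`. -/
def embTangent {D : ℕ} (V : Set (Fin D → ℂ)) (x : Fin D → ℂ) :
    Submodule ℂ (Fin D → ℂ) where
  carrier := { v | ∀ f : MvPolynomial (Fin D) ℂ,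
    (∀ y ∈ V, MvPolynomial.eval y f = 0) →
      ∑ i, v i * MvPolynomial.eval x (MvPolynomial.pderiv i f) = 0 }
  add_mem' := by
    intro a b ha hb f hf
    simp only [Pi.add_apply, add_mul, Finset.sum_add_distrib, ha f hf, hb f hf, add_zero]
  zero_mem' := by
    intro f hf
    simp
  smul_mem' := by
    intro c a ha f hf
    simp only [Pi.smul_apply, smul_eq_mul, mul_assoc, ← Finset.mul_sum, ha f hf, mul_zero]

/-- The `i`-th component of a point of the affine space `ℂ^(Fin k × Fin D)` of `k`-tuples. -/
def comp {k D : ℕ} (z : Fin k × Fin D → ℂ) (i : Fin k) : Fin D → ℂ := fun j => z (i, j)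

/-- The product `V^m × V'`, viewed inside the affine space of `(m+1)`-tuples. -/
def prodSet {D : ℕ} (m : ℕ) (V V' : Set (Fin D → ℂ)) : Set (Fin (m + 1) × Fin D → ℂ) :=
  { z | (∀ i : Fin m, comp z i.castSucc ∈ V) ∧ comp z (Fin.last m) ∈ V' }

/-- `P m` (for `m ≥ 1`): the set of tuples in `O^m × O'` on which the intersection of the
span of the `m` tangent spaces to `V` with the tangent space to `V'` is `⊥` is dense in
`V^m × V'`; and `P 0 := True`. -/
def Pprop {D : ℕ} (V V' O O' : Set (Fin D → ℂ)) (m : ℕ) : Prop :=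
  m = 0 ∨
    prodSet m V V' ⊆ zClosure
      { z ∈ prodSet m O O' |
        (⨆ i : Fin m, embTangent V (comp z i.castSucc)) ⊓
          embTangent V' (comp z (Fin.last m)) = ⊥ }

/-- `Q m`: there exist `x₁, …, x_m ∈ O` whose tangent spaces to `V` span all of `ℂ^D`. -/
def Qprop {D : ℕ} (V O : Set (Fin D → ℂ)) (m : ℕ) : Prop :=
  ∃ x : Fin m → (Fin D → ℂ), (∀ i, x i ∈ O) ∧ (⨆ i, embTangent V (x i)) = ⊤

/-! ### Polynomial functions -/

/-- The algebra of polynomial functions on `τ → ℂ`. -/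
def polyFun (τ : Type*) : Subalgebra ℂ ((τ → ℂ) → ℂ) :=
  (MvPolynomial.aeval (R := ℂ) (fun (i : τ) (z : τ → ℂ) => z i)).range

theorem mem_polyFun {τ : Type*} {F : (τ → ℂ) → ℂ} :
    F ∈ polyFun τ ↔ ∃ f : MvPolynomial τ ℂ, ∀ z, F z = MvPolynomial.eval z f := by
  have key : ∀ (f : MvPolynomial τ ℂ) (z : τ → ℂ),
      (MvPolynomial.aeval (R := ℂ) (fun (i : τ) (z : τ → ℂ) => z i)) f z =
        MvPolynomial.eval z f := by
    intro f z
    induction f using MvPolynomial.induction_on with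
    | C a => simp
    | add p q hp hq => simp [hp, hq]
    | mul_X p i hp => simp [hp]
  constructor
  · rintro ⟨f, rfl⟩
    exact ⟨f, fun z => key f z⟩
  · rintro ⟨f, hf⟩
    exact ⟨f, funext fun z => (key f z).trans (hf z).symm⟩

theorem eval_mem_polyFun {τ : Type*} (f : MvPolynomial τ ℂ) :
    (fun z => MvPolynomial.eval z f) ∈ polyFun τ :=
  mem_polyFun.2 ⟨f, fun _ => rfl⟩

theorem coord_mem_polyFun {τ : Type*} (i : τ) : (fun z : τ → ℂ => z i) ∈ polyFun τ :=
  mem_polyFun.2 ⟨MvPolynomial.X i, fun z => by simp⟩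

theorem const_mem_polyFun {τ : Type*} (c : ℂ) : (fun _ : τ → ℂ => c) ∈ polyFun τ :=
  mem_polyFun.2 ⟨MvPolynomial.C c, fun z => by simp⟩

theorem sum_mem_polyFun {τ ι : Type*} (s : Finset ι) {F : ι → (τ → ℂ) → ℂ}
    (hF : ∀ i, F i ∈ polyFun τ) : (fun z => ∑ i ∈ s, F i z) ∈ polyFun τ := by
  have : (fun z => ∑ i ∈ s, F i z) = ∑ i ∈ s, F i := by ext z; simp
  rw [this]
  exact sum_mem fun i _ => hF i

theorem comp_mem_polyFun {σ τ : Type*} {F : (σ → ℂ) → ℂ} (hF : F ∈ polyFun σ)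
    {φ : (τ → ℂ) → (σ → ℂ)} (hφ : ∀ i, (fun z => φ z i) ∈ polyFun τ) :
    (fun z => F (φ z)) ∈ polyFun τ := by
  obtain ⟨f, hf⟩ := mem_polyFun.1 hF
  simp only [hf]
  induction f using MvPolynomial.induction_on generalizing F with
  | C a => simpa using const_mem_polyFun a
  | add p q hp hq =>
    simp only [map_add]
    exact add_mem (hp (eval_mem_polyFun p) fun _ => rfl) (hq (eval_mem_polyFun q) fun _ => rfl)
  | mul_X p i hp =>
    simp only [map_mul, MvPolynomial.eval_X]
    exact mul_mem (hp (eval_mem_polyFun p) fun _ => rfl) (hφ i)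

theorem det_mem_polyFun {τ ι : Type*} [Fintype ι] [DecidableEq ι]
    {M : (τ → ℂ) → Matrix ι ι ℂ} (hM : ∀ i j, (fun z => M z i j) ∈ polyFun τ) :
    (fun z => (M z).det) ∈ polyFun τ := by
  have : (fun z => (M z).det) =
      ∑ σ : Equiv.Perm ι, Equiv.Perm.sign σ • ∏ i, fun z => M z (σ i) i := by
    ext z
    simp [Matrix.det_apply, Units.smul_def]
  rw [this]
  refine sum_mem fun σ _ => ?_
  rw [Units.smul_def]
  exact zsmul_mem (prod_mem fun i _ => hM _ _) _

theorem adjugate_mem_polyFun {τ ι : Type*} [Fintype ι] [DecidableEq ι]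
    {M : (τ → ℂ) → Matrix ι ι ℂ} (hM : ∀ i j, (fun z => M z i j) ∈ polyFun τ) (i j : ι) :
    (fun z => (M z).adjugate i j) ∈ polyFun τ := by
  simp only [Matrix.adjugate_apply]
  refine det_mem_polyFun fun a b => ?_
  by_cases h : a = j
  · subst h
    simpa using const_mem_polyFun _
  · simpa [Matrix.updateRow_ne h] using hM a b

theorem mul_entry_mem_polyFun {τ ι κ μ : Type*} [Fintype κ]
    {A : (τ → ℂ) → Matrix ι κ ℂ} {B : (τ → ℂ) → Matrix κ μ ℂ}
    (hA : ∀ i j, (fun z => A z i j) ∈ polyFun τ) (hB : ∀ i j, (fun z => B z i j) ∈ polyFun τ)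
    (i : ι) (j : μ) : (fun z => (A z * B z) i j) ∈ polyFun τ := by
  simp only [Matrix.mul_apply]
  exact sum_mem_polyFun _ fun k => mul_mem (hA i k) (hB k j)

theorem mulVec_mem_polyFun {τ ι κ : Type*} [Fintype κ]
    {A : (τ → ℂ) → Matrix ι κ ℂ} {v : (τ → ℂ) → κ → ℂ}
    (hA : ∀ i j, (fun z => A z i j) ∈ polyFun τ) (hv : ∀ j, (fun z => v z j) ∈ polyFun τ)
    (i : ι) : (fun z => (A z).mulVec (v z) i) ∈ polyFun τ := by
  simp only [Matrix.mulVec, dotProduct]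
  exact sum_mem_polyFun _ fun k => mul_mem (hA i k) (hv k)

theorem exists_right_inverse_of_linearIndependent {ι κ : Type*} [Fintype ι] [DecidableEq ι]
    [Fintype κ] {A : Matrix ι κ ℂ} (hA : LinearIndependent ℂ A.row) :
    ∃ R : Matrix κ ι ℂ, A * R = 1 := by
  rw [← Matrix.mulVec_surjective_iff_exists_right_inverse]
  have h : Module.finrank ℂ A.mulVecLin.range = Module.finrank ℂ (ι → ℂ) := by
    rw [← Matrix.rank, hA.rank_matrix, Module.finrank_fintype_fun_eq_card]
  exact LinearMap.range_eq_top.1 (Submodule.eq_top_of_finrank_eq h)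

/-! ### Families of subspaces with enough polynomial sections -/

/-- A family of subspaces over `S` has enough polynomial sections if every vector of every
member extends to a polynomial map whose values on `S` lie in the family. -/
def HasSections {τ : Type*} {D : ℕ} (S : Set (τ → ℂ))
    (T : (τ → ℂ) → Submodule ℂ (Fin D → ℂ)) : Prop :=
  ∀ x₀ ∈ S, ∀ v₀ ∈ T x₀, ∃ s : (τ → ℂ) → (Fin D → ℂ),
    (∀ j, (fun x => s x j) ∈ polyFun τ) ∧ (∀ x ∈ S, s x ∈ T x) ∧ s x₀ = v₀

theorem HasSections.pullback {σ τ : Type*} {D : ℕ} {S : Set (σ → ℂ)}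
    {T : (σ → ℂ) → Submodule ℂ (Fin D → ℂ)} (h : HasSections S T)
    {φ : (τ → ℂ) → (σ → ℂ)} (hφ : ∀ i, (fun z => φ z i) ∈ polyFun τ)
    {S' : Set (τ → ℂ)} (hS' : ∀ z ∈ S', φ z ∈ S) :
    HasSections S' fun z => T (φ z) := by
  intro x₀ hx₀ v₀ hv₀
  obtain ⟨s, hs, hsT, hs₀⟩ := h _ (hS' _ hx₀) v₀ hv₀
  exact ⟨fun z => s (φ z), fun j => comp_mem_polyFun (hs j) hφ,
    fun x hx => hsT _ (hS' _ hx), hs₀⟩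

theorem HasSections.iSup {τ ι : Type*} {D : ℕ} {S : Set (τ → ℂ)}
    {T : ι → (τ → ℂ) → Submodule ℂ (Fin D → ℂ)} (h : ∀ i, HasSections S (T i)) :
    HasSections S fun z => ⨆ i, T i z := by
  intro x₀ hx₀ v₀ hv₀
  refine Submodule.iSup_induction (fun i => T i x₀)
    (motive := fun v => ∃ s : (τ → ℂ) → (Fin D → ℂ), (∀ j, (fun x => s x j) ∈ polyFun τ) ∧
      (∀ x ∈ S, s x ∈ ⨆ i, T i x) ∧ s x₀ = v) hv₀
    (fun i v hv => ?_) ?_ ?_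
  · obtain ⟨s, hs, hsT, hs₀⟩ := h i x₀ hx₀ v hv
    exact ⟨s, hs, fun x hx => Submodule.mem_iSup_of_mem i (hsT x hx), hs₀⟩
  · exact ⟨0, fun j => zero_mem _, fun x _ => zero_mem _, rfl⟩
  · rintro u v ⟨s, hs, hsT, hs₀⟩ ⟨t, ht, htT, ht₀⟩
    exact ⟨s + t, fun j => add_mem (hs j) (ht j),
      fun x hx => add_mem (hsT x hx) (htT x hx), by simp [hs₀, ht₀]⟩

theorem HasSections.sup {τ : Type*} {D : ℕ} {S : Set (τ → ℂ)}
    {T T' : (τ → ℂ) → Submodule ℂ (Fin D → ℂ)} (h : HasSections S T) (h' : HasSections S T') :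
    HasSections S fun z => T z ⊔ T' z := by
  simp only [sup_eq_iSup]
  refine HasSections.iSup fun b => ?_
  cases b <;> assumption

/-- The rank of a family with enough polynomial sections is lower semicontinuous. -/
theorem HasSections.exists_le_finrank {τ : Type*} {D : ℕ} {S : Set (τ → ℂ)}
    {T : (τ → ℂ) → Submodule ℂ (Fin D → ℂ)} (h : HasSections S T) {x₀ : τ → ℂ} (hx₀ : x₀ ∈ S) :
    ∃ F ∈ polyFun τ, F x₀ ≠ 0 ∧
      ∀ x ∈ S, F x ≠ 0 → Module.finrank ℂ (T x₀) ≤ Module.finrank ℂ (T x) := by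
  let b := Module.finBasis ℂ (T x₀)
  choose s hs hsT hs₀ using fun a => h x₀ hx₀ (b a) (b a).2
  let A : (τ → ℂ) → Matrix (Fin (Module.finrank ℂ (T x₀))) (Fin D) ℂ := fun x => .of fun a => s a x
  have hA₀ : LinearIndependent ℂ (A x₀).row := by
    have : (A x₀).row = fun a => (T x₀).subtype (b a) := by
      ext a j
      simp [A, hs₀]
    rw [this]
    exact b.linearIndependent.map' _ (Submodule.ker_subtype _)
  obtain ⟨R, hR⟩ := exists_right_inverse_of_linearIndependent hA₀
  refine ⟨fun x => (A x * R).det, det_mem_polyFun (mul_entry_mem_polyFun (fun a j => hs a j)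
    fun _ _ => const_mem_polyFun _), by simp [hR], fun x hx hdet => ?_⟩
  have hli : LinearIndependent ℂ fun a => (⟨s a x, hsT a x hx⟩ : T x) := by
    rw [Fintype.linearIndependent_iff]
    intro c hc
    have hc' : Matrix.vecMul c (A x) = 0 := by
      ext j
      have := congrArg (fun v : T x => (v : Fin D → ℂ) j) hc
      simpa [Matrix.vecMul, dotProduct, A] using this
    have h0 : Matrix.vecMul c (A x * R) = 0 := by
      rw [← Matrix.vecMul_vecMul, hc', Matrix.zero_vecMul]
    exact fun i => congrFun (Matrix.eq_zero_of_vecMul_eq_zero hdet h0) i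
  simpa using hli.fintype_card_le_finrank

/-! ### Tangent spaces -/

/-- The gradient at `x` as a linear map in the polynomial. -/
def polyGrad {D : ℕ} (x : Fin D → ℂ) : MvPolynomial (Fin D) ℂ →ₗ[ℂ] (Fin D → ℂ) :=
  LinearMap.pi fun i => (MvPolynomial.aeval x).toLinearMap ∘ₗ (MvPolynomial.pderiv i).toLinearMap

theorem polyGrad_apply {D : ℕ} (x : Fin D → ℂ) (f : MvPolynomial (Fin D) ℂ) (i : Fin D) :
    polyGrad x f i = MvPolynomial.eval x (MvPolynomial.pderiv i f) := by
  simp [polyGrad]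

theorem mem_embTangent {D : ℕ} {V : Set (Fin D → ℂ)} {x v : Fin D → ℂ} :
    v ∈ embTangent V x ↔ ∀ f : MvPolynomial (Fin D) ℂ,
      (∀ y ∈ V, MvPolynomial.eval y f = 0) → polyGrad x f ⬝ᵥ v = 0 := by
  simp only [dotProduct, polyGrad_apply, mul_comm _ (v _)]
  rfl

/-- The linear subspace of polynomials vanishing on `V`. -/
def vanishing {D : ℕ} (V : Set (Fin D → ℂ)) : Submodule ℂ (MvPolynomial (Fin D) ℂ) where
  carrier := {f | ∀ y ∈ V, MvPolynomial.eval y f = 0}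
  add_mem' := fun ha hb y hy => by simp [ha y hy, hb y hy]
  zero_mem' := fun y _ => by simp
  smul_mem' := fun c f hf y hy => by simp [hf y hy]

theorem hasSections_embTangent {D N : ℕ} {V O : Set (Fin D → ℂ)}
    (hN : ∀ x ∈ O, Module.finrank ℂ (embTangent V x) = N) :
    HasSections O (embTangent V) := by
  intro x₀ hx₀ v₀ hv₀
  let Γ := (vanishing V).map (polyGrad x₀)
  let b := Module.finBasis ℂ Γ
  choose f hfV hf using fun a => (b a).2
  let M : (Fin D → ℂ) → Matrix (Fin (Module.finrank ℂ Γ)) (Fin D) ℂ :=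
    fun x => .of fun a => polyGrad x (f a)
  have hM : ∀ a j, (fun x => M x a j) ∈ polyFun (Fin D) := fun a j => by
    simpa [M, polyGrad_apply] using eval_mem_polyFun _
  have hM₀ : LinearIndependent ℂ (M x₀).row := by
    have : (M x₀).row = fun a => Γ.subtype (b a) := by
      ext a j
      simp [M, hf]
    rw [this]
    exact b.linearIndependent.map' _ (Submodule.ker_subtype _)
  obtain ⟨R, hR⟩ := exists_right_inverse_of_linearIndependent hM₀
  have hle : ∀ x, embTangent V x ≤ (M x).mulVecLin.ker := by
    intro x v hv
    ext a
    exact mem_embTangent.1 hv (f a) (hfV a)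
  have hker₀ : embTangent V x₀ = (M x₀).mulVecLin.ker := by
    refine le_antisymm (hle x₀) fun v hv => mem_embTangent.2 fun g hg => ?_
    have hgΓ : polyGrad x₀ g ∈ Γ := ⟨g, hg, rfl⟩
    have hsum := congrArg Γ.subtype (b.sum_repr ⟨_, hgΓ⟩)
    simp only [map_sum, map_smul, Submodule.subtype_apply] at hsum
    rw [← hsum, sum_dotProduct]
    refine Finset.sum_eq_zero fun a _ => ?_
    have : (M x₀).mulVec v a = 0 := congrFun hv a
    rw [smul_dotProduct, ← hf a]
    simpa [M, Matrix.mulVec] using Or.inr this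
  have hsurj : ∀ x, (M x * R).det ≠ 0 → Module.finrank ℂ (M x).mulVecLin.ker + Module.finrank ℂ Γ =
      D := by
    intro x hx
    have hs : Function.Surjective (M x).mulVec := by
      rw [Matrix.mulVec_surjective_iff_exists_right_inverse]
      exact ⟨R * (M x * R)⁻¹, by
        rw [← Matrix.mul_assoc, Matrix.mul_nonsing_inv _ (isUnit_iff_ne_zero.2 hx)]⟩
    have := (M x).mulVecLin.finrank_range_add_finrank_ker
    rw [(LinearMap.range_eq_top (f := (M x).mulVecLin)).2 hs, finrank_top] at this
    simp at this
    omega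
  have hker : ∀ x ∈ O, (M x * R).det ≠ 0 → embTangent V x = (M x).mulVecLin.ker := by
    intro x hx hdet
    refine Submodule.eq_of_le_of_finrank_eq (hle x) ?_
    have h1 := hsurj x hdet
    have h0 := hsurj x₀ (by simp [hR])
    rw [← hker₀, hN x₀ hx₀] at h0
    rw [hN x hx]
    omega
  refine ⟨fun x => (M x * R).det • ((M x * R).det • v₀ -
    R.mulVec ((M x * R).adjugate.mulVec ((M x).mulVec v₀))), fun j => ?_, fun x hx => ?_, ?_⟩
  · have hc : ∀ i j, (fun _ : Fin D → ℂ => R i j) ∈ polyFun (Fin D) :=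
      fun _ _ => const_mem_polyFun _
    have hMR := mul_entry_mem_polyFun hM hc
    have hdet := det_mem_polyFun hMR
    have hw := mulVec_mem_polyFun hM fun j => const_mem_polyFun (v₀ j)
    have hadj := mulVec_mem_polyFun (adjugate_mem_polyFun hMR) hw
    have hsub := sub_mem (mul_mem hdet (const_mem_polyFun (v₀ j))) (mulVec_mem_polyFun hc hadj j)
    exact mul_mem hdet hsub
  · by_cases hdet : (M x * R).det = 0
    · simp [hdet]
    · rw [hker x hx hdet]
      refine Submodule.smul_mem _ _ ?_
      rw [LinearMap.mem_ker, Matrix.mulVecLin_apply, Matrix.mulVec_sub, Matrix.mulVec_smul,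
        Matrix.mulVec_mulVec, Matrix.mulVec_mulVec, Matrix.mul_adjugate, Matrix.smul_mulVec,
        Matrix.one_mulVec, sub_self]
  · have : (M x₀).mulVec v₀ = 0 := hle x₀ hv₀
    simp [hR, this]

theorem polyGrad_mul {D : ℕ} (x : Fin D → ℂ) (f g : MvPolynomial (Fin D) ℂ) :
    polyGrad x (f * g) =
      MvPolynomial.eval x f • polyGrad x g + MvPolynomial.eval x g • polyGrad x f := by
  ext i
  simp [polyGrad_apply, Derivation.leibniz]

theorem exists_pullback_linearMap {D : ℕ} (L : (Fin D → ℂ) →ₗ[ℂ] (Fin D → ℂ))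
    (f : MvPolynomial (Fin D) ℂ) : ∃ f' : MvPolynomial (Fin D) ℂ,
      (∀ x, MvPolynomial.eval x f' = MvPolynomial.eval (L x) f) ∧
      ∀ x v, polyGrad x f' ⬝ᵥ v = polyGrad (L x) f ⬝ᵥ L v := by
  have hX : ∀ (x : Fin D → ℂ) (i : Fin D), polyGrad x (MvPolynomial.X i) = Pi.single i 1 := by
    intro x i
    ext j
    rw [polyGrad_apply, MvPolynomial.pderiv_X]
    by_cases h : i = j
    · subst h; simp
    · simp [h, Ne.symm h]
  have hL : ∀ x i, L x i = ∑ j, x j * L (Pi.single j 1) i := by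
    intro x i
    conv_lhs => rw [pi_eq_sum_univ' x]
    simp
  induction f using MvPolynomial.induction_on with
  | C a =>
    refine ⟨MvPolynomial.C a, by simp, fun x v => ?_⟩
    simp [dotProduct, polyGrad_apply]
  | add p q hp hq =>
    obtain ⟨p', hp, hp'⟩ := hp
    obtain ⟨q', hq, hq'⟩ := hq
    exact ⟨p' + q', by simp [hp, hq], by simp [add_dotProduct, hp', hq']⟩
  | mul_X p i hp =>
    obtain ⟨p', hp, hp'⟩ := hp
    let ℓ : MvPolynomial (Fin D) ℂ := ∑ j, L (Pi.single j 1) i • MvPolynomial.X j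
    have hℓ : ∀ x, MvPolynomial.eval x ℓ = L x i := fun x => by
      simp [ℓ, hL x i, mul_comm]
    have hℓ' : ∀ x v, polyGrad x ℓ ⬝ᵥ v = L v i := fun x v => by
      simp [ℓ, hL v i, hX, sum_dotProduct, mul_comm]
    exact ⟨p' * ℓ, by simp [hp, hℓ], fun x v => by
      simp [polyGrad_mul, add_dotProduct, hp, hℓ, hp', hℓ', hX]⟩

theorem map_embTangent_le {D : ℕ} {V : Set (Fin D → ℂ)} (L : (Fin D → ℂ) →ₗ[ℂ] (Fin D → ℂ))
    (hL : ∀ x ∈ V, L x ∈ V) (x : Fin D → ℂ) :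
    (embTangent V x).map L ≤ embTangent V (L x) := by
  rintro _ ⟨v, hv, rfl⟩
  refine mem_embTangent.2 fun f hf => ?_
  obtain ⟨f', h, h'⟩ := exists_pullback_linearMap L f
  rw [← h']
  exact mem_embTangent.1 hv f' fun y hy => (h y).trans (hf _ (hL y hy))

/-! ### Generic points of products of irreducible sets -/

theorem exists_poly_of_zIsOpen {ι : Type*} {U : Set (ι → ℂ)} (hU : zIsOpen U) {x : ι → ℂ}
    (hx : x ∈ U) : ∃ f : MvPolynomial ι ℂ, MvPolynomial.eval x f ≠ 0 ∧
      ∀ y, MvPolynomial.eval y f ≠ 0 → y ∈ U := by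
  have hU' : TopologicalSpace.GenerateOpen
    { U | ∃ f : MvPolynomial ι ℂ, U = { x | MvPolynomial.eval x f ≠ 0 } } U := hU
  induction hU' with
  | basic s hs =>
    obtain ⟨f, rfl⟩ := hs
    exact ⟨f, hx, fun _ h => h⟩
  | univ => exact ⟨1, by simp, fun _ _ => trivial⟩
  | inter s t hs ht ihs iht =>
    obtain ⟨f, hf, hfs⟩ := ihs hs hx.1
    obtain ⟨g, hg, hgt⟩ := iht ht hx.2
    refine ⟨f * g, by simp [hf, hg], fun y hy => ?_⟩
    rw [map_mul] at hy
    exact ⟨hfs y (left_ne_zero_of_mul hy), hgt y (right_ne_zero_of_mul hy)⟩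
  | sUnion S hS ih =>
    obtain ⟨s, hs, hxs⟩ := hx
    obtain ⟨f, hf, hfs⟩ := ih s hs (hS s hs) hxs
    exact ⟨f, hf, fun y hy => ⟨s, hs, hfs y hy⟩⟩

theorem zIsOpen_ne_zero {ι : Type*} {F : (ι → ℂ) → ℂ} (hF : F ∈ polyFun ι) :
    zIsOpen {x | F x ≠ 0} := by
  obtain ⟨f, hf⟩ := mem_polyFun.1 hF
  exact TopologicalSpace.GenerateOpen.basic _ ⟨f, by simp only [hf]⟩

theorem zIsIrreducible.nonempty {ι : Type*} {S : Set (ι → ℂ)} (hS : zIsIrreducible S) :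
    S.Nonempty :=
  hS.1

theorem zIsIrreducible.exists_ne_zero {ι : Type*} {S : Set (ι → ℂ)} (hS : zIsIrreducible S)
    {F G : (ι → ℂ) → ℂ} (hF : F ∈ polyFun ι) (hG : G ∈ polyFun ι) {x y : ι → ℂ}
    (hx : x ∈ S) (hy : y ∈ S) (hFx : F x ≠ 0) (hGy : G y ≠ 0) :
    ∃ z ∈ S, F z ≠ 0 ∧ G z ≠ 0 :=
  hS.2 _ _ (zIsOpen_ne_zero hF) (zIsOpen_ne_zero hG) ⟨x, hx, hFx⟩ ⟨y, hy, hGy⟩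

theorem IsDenseOpenSubset.nonempty {ι : Type*} {O S : Set (ι → ℂ)} (h : IsDenseOpenSubset O S)
    (hS : S.Nonempty) : O.Nonempty := by
  let := zt ι
  obtain ⟨x, hx⟩ := hS
  exact closure_nonempty_iff.1 ⟨x, h.2.2 hx⟩

/-- The product of a finite family of subsets of `ℂ^D`. -/
def box {k D : ℕ} (X : Fin k → Set (Fin D → ℂ)) : Set (Fin k × Fin D → ℂ) :=
  {z | ∀ i, comp z i ∈ X i}

/-- The tuple with the components of `w` on `s` and those of `z` elsewhere. -/
def mix {k D : ℕ} (s : Set (Fin k)) (w z : Fin k × Fin D → ℂ) : Fin k × Fin D → ℂ :=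
  open Classical in fun ij => if ij.1 ∈ s then w ij else z ij

theorem comp_mix_of_mem {k D : ℕ} {s : Set (Fin k)} (w z : Fin k × Fin D → ℂ) {i : Fin k}
    (hi : i ∈ s) : comp (mix s w z) i = comp w i := by
  ext j
  simp [comp, mix, hi]

theorem comp_mix_of_notMem {k D : ℕ} {s : Set (Fin k)} (w z : Fin k × Fin D → ℂ) {i : Fin k}
    (hi : i ∉ s) : comp (mix s w z) i = comp z i := by
  ext j
  simp [comp, mix, hi]

theorem mix_self {k D : ℕ} (s : Set (Fin k)) (w : Fin k × Fin D → ℂ) : mix s w w = w := by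
  ext ij
  simp [mix]

theorem mix_mem_box {k D : ℕ} {X : Fin k → Set (Fin D → ℂ)} {s : Set (Fin k)}
    {w z : Fin k × Fin D → ℂ} (hw : ∀ i ∈ s, comp w i ∈ X i) (hz : z ∈ box X) :
    mix s w z ∈ box X := by
  intro i
  by_cases hi : i ∈ s
  · rw [comp_mix_of_mem _ _ hi]
    exact hw i hi
  · rw [comp_mix_of_notMem _ _ hi]
    exact hz i

theorem comp_coord_mem_polyFun {k D : ℕ} (i : Fin k) (j : Fin D) :
    (fun z : Fin k × Fin D → ℂ => comp z i j) ∈ polyFun (Fin k × Fin D) :=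
  coord_mem_polyFun (i, j)

/-- Two nonzero polynomial functions on a product of irreducible sets are simultaneously nonzero
at some point. -/
theorem exists_ne_zero_box {k D : ℕ} {X : Fin k → Set (Fin D → ℂ)}
    (hX : ∀ i, zIsIrreducible (X i)) {F G : (Fin k × Fin D → ℂ) → ℂ}
    (hF : F ∈ polyFun _) (hG : G ∈ polyFun _) {p q : Fin k × Fin D → ℂ}
    (hp : p ∈ box X) (hq : q ∈ box X) (hFp : F p ≠ 0) (hGq : G q ≠ 0) :
    ∃ z ∈ box X, F z ≠ 0 ∧ G z ≠ 0 := by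
  have key : ∀ s : Finset (Fin k), ∃ p ∈ box X, ∃ q ∈ box X, F p ≠ 0 ∧ G q ≠ 0 ∧
      ∀ i ∈ s, comp p i = comp q i := by
    intro s
    induction s using Finset.induction_on with
    | empty => exact ⟨p, hp, q, hq, hFp, hGq, by simp⟩
    | insert i s _ ih =>
      obtain ⟨p, hp, q, hq, hFp, hGq, hpq⟩ := ih
      let ins : (Fin k × Fin D → ℂ) → (Fin D → ℂ) → (Fin k × Fin D → ℂ) :=
        fun z t => mix {i} (fun ij => t ij.2) z
      have hins : ∀ z, ins z (comp z i) = z := by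
        intro z
        ext ⟨a, b⟩
        by_cases h : a = i
        · simp [ins, mix, comp, h]
        · simp [ins, mix, h]
      have hpoly : ∀ z ij, (fun t => ins z t ij) ∈ polyFun (Fin D) := by
        rintro z ⟨a, b⟩
        by_cases h : a = i
        · simpa [ins, mix, h] using coord_mem_polyFun b
        · simpa [ins, mix, h] using const_mem_polyFun (z (a, b))
      obtain ⟨t, ht, hFt, hGt⟩ := (hX i).exists_ne_zero (comp_mem_polyFun hF (hpoly p))
        (comp_mem_polyFun hG (hpoly q)) (hp i) (hq i) (by rwa [hins]) (by rwa [hins])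
      have hbox : ∀ z ∈ box X, ins z t ∈ box X := fun z hz =>
        mix_mem_box (by rintro _ rfl; exact ht) hz
      refine ⟨ins p t, hbox p hp, ins q t, hbox q hq, hFt, hGt, fun j hj => ?_⟩
      by_cases h : j = i
      · rw [comp_mix_of_mem _ _ (by simpa using h), comp_mix_of_mem _ _ (by simpa using h)]
      · rw [comp_mix_of_notMem _ _ (by simpa using h), comp_mix_of_notMem _ _ (by simpa using h)]
        exact hpq j (Finset.mem_of_mem_insert_of_ne hj h)
  obtain ⟨p, hp, q, hq, hFp, hGq, hpq⟩ := key Finset.univ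
  have : p = q := by
    ext ⟨i, j⟩
    exact congrFun (hpq i (Finset.mem_univ i)) j
  subst this
  exact ⟨p, hp, hFp, hGq⟩

theorem box_nonempty {k D : ℕ} {X : Fin k → Set (Fin D → ℂ)}
    (hX : ∀ i, zIsIrreducible (X i)) : (box X).Nonempty := by
  choose x hx using fun i => (hX i).nonempty
  exact ⟨fun ij => x ij.1 ij.2, hx⟩

/-- The filter of sets containing a nonempty principal open subset of the product of irreducible
sets. -/
def generic {k D : ℕ} {X : Fin k → Set (Fin D → ℂ)} (hX : ∀ i, zIsIrreducible (X i)) :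
    Filter (Fin k × Fin D → ℂ) where
  sets := {R | ∃ F ∈ polyFun (Fin k × Fin D), (∃ z ∈ box X, F z ≠ 0) ∧
    ∀ z ∈ box X, F z ≠ 0 → z ∈ R}
  univ_sets := by
    obtain ⟨z, hz⟩ := box_nonempty hX
    exact ⟨1, one_mem _, ⟨z, hz, one_ne_zero⟩, fun _ _ _ => trivial⟩
  sets_of_superset := by
    rintro R R' ⟨F, hF, hz, hR⟩ hRR'
    exact ⟨F, hF, hz, fun z hz hFz => hRR' (hR z hz hFz)⟩
  inter_sets := by
    rintro R R' ⟨F, hF, ⟨p, hp, hFp⟩, hR⟩ ⟨G, hG, ⟨q, hq, hGq⟩, hR'⟩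
    obtain ⟨z, hz, hFz, hGz⟩ := exists_ne_zero_box hX hF hG hp hq hFp hGq
    exact ⟨F * G, mul_mem hF hG, ⟨z, hz, mul_ne_zero hFz hGz⟩, fun z hz hFG =>
      ⟨hR z hz (left_ne_zero_of_mul hFG), hR' z hz (right_ne_zero_of_mul hFG)⟩⟩

section Generic

variable {k D : ℕ} {X : Fin k → Set (Fin D → ℂ)} (hX : ∀ i, zIsIrreducible (X i))

theorem eventually_generic {R : (Fin k × Fin D → ℂ) → Prop} :
    (∀ᶠ z in generic hX, R z) ↔ ∃ F ∈ polyFun (Fin k × Fin D), (∃ z ∈ box X, F z ≠ 0) ∧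
      ∀ z ∈ box X, F z ≠ 0 → R z :=
  Iff.rfl

instance generic_neBot : (generic hX).NeBot := by
  refine ⟨fun h => ?_⟩
  obtain ⟨F, -, ⟨z, hz, hFz⟩, h⟩ := (eventually_generic hX (R := fun _ => False)).1 (by simp [h])
  exact h z hz hFz

theorem eventually_mem_box : ∀ᶠ z in generic hX, z ∈ box X := by
  obtain ⟨z, hz⟩ := box_nonempty hX
  exact (eventually_generic hX).2 ⟨1, one_mem _, ⟨z, hz, one_ne_zero⟩, fun _ hz _ => hz⟩

theorem eventually_comp_mem {O : Set (Fin D → ℂ)} {i : Fin k} (hO : IsDenseOpenSubset O (X i)) :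
    ∀ᶠ z in generic hX, comp z i ∈ O := by
  have hne := hO.nonempty (hX i).nonempty
  obtain ⟨-, ⟨U, hU, rfl⟩, -⟩ := hO
  obtain ⟨x, hxU, hx⟩ := hne
  obtain ⟨f, hfx, hf⟩ := exists_poly_of_zIsOpen hU hxU
  obtain ⟨z, hz⟩ := box_nonempty hX
  refine (eventually_generic hX).2 ⟨fun z => MvPolynomial.eval (comp z i) f,
    comp_mem_polyFun (eval_mem_polyFun f) (comp_coord_mem_polyFun i),
    ⟨mix {i} (fun ij => x ij.2) z, mix_mem_box (by rintro _ rfl; exact hx) hz, ?_⟩,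
    fun z hz hfz => ⟨hf _ hfz, hz i⟩⟩
  simp only [comp_mix_of_mem _ _ (Set.mem_singleton i)]
  exact hfx

theorem exists_eventually_mix {R : (Fin k × Fin D → ℂ) → Prop} (hR : ∀ᶠ z in generic hX, R z)
    (s : Set (Fin k)) : ∃ w, R w ∧ ∀ᶠ z in generic hX, R (mix s w z) := by
  obtain ⟨F, hF, ⟨w, hw, hFw⟩, h⟩ := (eventually_generic hX).1 hR
  refine ⟨w, h w hw hFw, (eventually_generic hX).2 ⟨fun z => F (mix s w z),
    comp_mem_polyFun hF fun ij => ?_, ⟨w, hw, by simpa only [mix_self] using hFw⟩,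
    fun z hz hFz => h _ (mix_mem_box (fun i _ => hw i) hz) hFz⟩⟩
  by_cases hi : ij.1 ∈ s
  · simpa [mix, hi] using const_mem_polyFun (w ij)
  · simpa [mix, hi] using coord_mem_polyFun ij

theorem eventually_linearEquiv {R : (Fin k × Fin D → ℂ) → Prop} (hR : ∀ᶠ z in generic hX, R z)
    (L : (Fin D → ℂ) ≃ₗ[ℂ] (Fin D → ℂ)) (hL : ∀ i, ∀ x ∈ X i, L x ∈ X i)
    (hL' : ∀ i, ∀ x ∈ X i, L.symm x ∈ X i) :
    ∀ᶠ z in generic hX, R fun ij => L (comp z ij.1) ij.2 := by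
  obtain ⟨F, hF, ⟨w, hw, hFw⟩, h⟩ := (eventually_generic hX).1 hR
  refine (eventually_generic hX).2 ⟨fun z => F fun ij => L (comp z ij.1) ij.2,
    comp_mem_polyFun hF fun ij => ?_, ⟨fun ij => L.symm (comp w ij.1) ij.2,
      fun i => hL' i _ (hw i), ?_⟩, fun z hz hFz => h _ (fun i => hL i _ (hz i)) hFz⟩
  · have : (fun z : Fin k × Fin D → ℂ => L (comp z ij.1) ij.2) =
        fun z => ∑ j, comp z ij.1 j * L (Pi.single j 1) ij.2 := by
      ext z
      conv_lhs => rw [pi_eq_sum_univ' (comp z ij.1)]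
      simp
    rw [this]
    exact sum_mem_polyFun _ fun j => mul_mem (comp_coord_mem_polyFun _ j) (const_mem_polyFun _)
  · have : (fun ij : Fin k × Fin D => L (L.symm (comp w ij.1)) ij.2) = w := by
      ext ⟨i, j⟩
      simp [comp]
    exact fun h => hFw (this ▸ h)

/-- The maximal rank of a family with enough polynomial sections is its generic rank. -/
theorem eventually_finrank_eq {S : Set (Fin k × Fin D → ℂ)} (hSX : S ⊆ box X)
    (hS : ∀ᶠ z in generic hX, z ∈ S) {T : (Fin k × Fin D → ℂ) → Submodule ℂ (Fin D → ℂ)}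
    (hT : HasSections S T) {d : ℕ} (hle : ∀ z ∈ S, Module.finrank ℂ (T z) ≤ d)
    (hd : ∃ z ∈ S, Module.finrank ℂ (T z) = d) :
    ∀ᶠ z in generic hX, Module.finrank ℂ (T z) = d := by
  obtain ⟨w, hw, rfl⟩ := hd
  obtain ⟨F, hF, hFw, h⟩ := hT.exists_le_finrank hw
  have hev : ∀ᶠ z in generic hX, F z ≠ 0 :=
    (eventually_generic hX).2 ⟨F, hF, ⟨w, hSX hw, hFw⟩, fun _ _ h => h⟩
  filter_upwards [hS, hev] with z hz hFz
  exact le_antisymm (hle z hz) (h z hz hFz)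

theorem box_subset_zClosure {A : Set (Fin k × Fin D → ℂ)} (hA : ∀ᶠ z in generic hX, z ∈ A) :
    box X ⊆ zClosure A := by
  intro z hz
  let := zt (Fin k × Fin D)
  refine mem_closure_iff.2 fun U hU hzU => ?_
  obtain ⟨f, hfz, hf⟩ := exists_poly_of_zIsOpen hU hzU
  have hev : ∀ᶠ z in generic hX, MvPolynomial.eval z f ≠ 0 :=
    (eventually_generic hX).2 ⟨_, eval_mem_polyFun f, ⟨z, hz, hfz⟩, fun _ _ h => h⟩
  obtain ⟨w, hwA, hfw⟩ := (hA.and hev).exists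
  exact ⟨w, hf w hfw, hwA⟩

end Generic

/-! ### Generic intersection dimension -/

/-- The factors of the product `V^n × V'`. -/
def factors {D : ℕ} (V V' : Set (Fin D → ℂ)) (n : ℕ) : Fin (n + 1) → Set (Fin D → ℂ) :=
  Fin.snoc (α := fun _ => Set (Fin D → ℂ)) (fun _ => V) V'

theorem forall_factors {D n : ℕ} {V V' : Set (Fin D → ℂ)}
    {p : Fin (n + 1) → Set (Fin D → ℂ) → Prop} :
    (∀ i, p i (factors V V' n i)) ↔ (∀ i : Fin n, p i.castSucc V) ∧ p (Fin.last n) V' := by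
  rw [Fin.forall_fin_succ']
  simp [factors]

theorem box_factors {D : ℕ} (V V' : Set (Fin D → ℂ)) (n : ℕ) :
    box (factors V V' n) = prodSet n V V' :=
  Set.ext fun z => forall_factors (p := fun i S => comp z i ∈ S)

theorem isIrreducible_factors {D : ℕ} {V V' : Set (Fin D → ℂ)} (hV : zIsIrreducible V)
    (hV' : zIsIrreducible V') (n : ℕ) (i : Fin (n + 1)) : zIsIrreducible (factors V V' n i) :=
  forall_factors (p := fun _ S => zIsIrreducible S).2 ⟨fun _ => hV, hV'⟩ i

/-- The maximal dimension of a span of `m` tangent spaces. -/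
def maxSpan {D : ℕ} (V O : Set (Fin D → ℂ)) (m : ℕ) : ℕ :=
  sSup {d | ∃ x : Fin m → (Fin D → ℂ), (∀ i, x i ∈ O) ∧
    Module.finrank ℂ (⨆ i, embTangent V (x i) : Submodule ℂ (Fin D → ℂ)) = d}

/-- The maximal dimension of a span of `m` tangent spaces to `V` and one tangent space to `V'`. -/
def maxJoin {D : ℕ} (V V' O O' : Set (Fin D → ℂ)) (m : ℕ) : ℕ :=
  sSup {d | ∃ x : Fin m → (Fin D → ℂ), (∀ i, x i ∈ O) ∧ ∃ y ∈ O',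
    Module.finrank ℂ ((⨆ i, embTangent V (x i)) ⊔ embTangent V' y :
      Submodule ℂ (Fin D → ℂ)) = d}

section Interval

variable {D : ℕ} {V V' O O' : Set (Fin D → ℂ)} (hV : zIsIrreducible V) (hV' : zIsIrreducible V')

theorem eventually_mem_prodSet (n : ℕ) (hO : IsDenseOpenSubset O V)
    (hO' : IsDenseOpenSubset O' V') :
    ∀ᶠ z in generic (isIrreducible_factors hV hV' n), z ∈ prodSet n O O' := by
  refine (Filter.eventually_all.2 fun i => eventually_comp_mem _ ?_).and
    (eventually_comp_mem _ ?_) <;> simpa [factors]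

theorem exists_mem_prodSet_extending {m n : ℕ} {e : Fin m → Fin n} (he : Function.Injective e)
    (hO : O.Nonempty) {x : Fin m → (Fin D → ℂ)} (hx : ∀ i, x i ∈ O) {y : Fin D → ℂ} (hy : y ∈ O') :
    ∃ z ∈ prodSet n O O', (∀ i, comp z (e i).castSucc = x i) ∧ comp z (Fin.last n) = y := by
  obtain ⟨o, ho⟩ := hO
  let p : Fin (n + 1) → (Fin D → ℂ) :=
    Fin.snoc (α := fun _ => Fin D → ℂ) (Function.extend e x fun _ => o) y
  have hcast : ∀ j : Fin n, p j.castSucc = Function.extend e x (fun _ => o) j := fun j => by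
    simp [p]
  have hlast : p (Fin.last n) = y := by simp [p]
  refine ⟨fun ij => p ij.1 ij.2, ⟨fun j => ?_, ?_⟩, fun i => ?_, hlast⟩
  · change p j.castSucc ∈ O
    rw [hcast]
    by_cases h : ∃ i, e i = j
    · obtain ⟨i, rfl⟩ := h
      rw [he.extend_apply]
      exact hx i
    · rw [Function.extend_apply' _ _ _ h]
      exact ho
  · change p (Fin.last n) ∈ O'
    rwa [hlast]
  · change p (e i).castSucc = x i
    rw [hcast, he.extend_apply]

theorem exists_eventually_finrank_inf {N N' : ℕ} (hO : IsDenseOpenSubset O V)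
    (hO' : IsDenseOpenSubset O' V')
    (hN : ∀ x ∈ O, Module.finrank ℂ (embTangent V x) = N)
    (hN' : ∀ y ∈ O', Module.finrank ℂ (embTangent V' y) = N') (m : ℕ) :
    ∃ d : ℕ, ∀ (n : ℕ) (e : Fin m → Fin n), Function.Injective e →
      ∀ᶠ z in generic (isIrreducible_factors hV hV' n),
        Module.finrank ℂ ((⨆ i, embTangent V (comp z (e i).castSucc)) ⊓
          embTangent V' (comp z (Fin.last n)) : Submodule ℂ (Fin D → ℂ)) = d := by
  refine ⟨maxSpan V O m + N' - maxJoin V V' O O' m, fun n e he => ?_⟩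
  obtain ⟨o, ho⟩ := hO.nonempty hV.nonempty
  obtain ⟨o', ho'⟩ := hO'.nonempty hV'.nonempty
  have hbd : ∀ T : Submodule ℂ (Fin D → ℂ), Module.finrank ℂ T ≤ D := fun T => by
    simpa using T.finrank_le
  have hmem := eventually_mem_prodSet hV hV' n hO hO'
  have hsub : prodSet n O O' ⊆ box (factors V V' n) := by
    rw [box_factors]
    exact fun z hz => ⟨fun i => hO.1 (hz.1 i), hO'.1 hz.2⟩
  have hspan : HasSections (prodSet n O O') fun z =>
      ⨆ i, embTangent V (comp z (e i).castSucc) :=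
    HasSections.iSup fun i => (hasSections_embTangent hN).pullback
      (comp_coord_mem_polyFun _) fun z hz => hz.1 (e i)
  have hjoin := hspan.sup ((hasSections_embTangent hN').pullback
      (S' := prodSet n O O') (comp_coord_mem_polyFun (Fin.last n)) fun z hz => hz.2)
  have h1 := eventually_finrank_eq _ hsub hmem hspan (d := maxSpan V O m)
    (fun z hz => le_csSup ⟨D, by rintro _ ⟨x, -, rfl⟩; exact hbd _⟩
      ⟨fun i => comp z (e i).castSucc, fun i => hz.1 _, rfl⟩) (by
      obtain ⟨x, hx, hd⟩ := Nat.sSup_mem (s := {d | ∃ x : Fin m → (Fin D → ℂ), (∀ i, x i ∈ O) ∧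
        Module.finrank ℂ (⨆ i, embTangent V (x i) : Submodule ℂ (Fin D → ℂ)) = d})
        ⟨_, fun _ => o, fun _ => ho, rfl⟩ ⟨D, by rintro _ ⟨x, -, rfl⟩; exact hbd _⟩
      obtain ⟨z, hz, hzx, -⟩ := exists_mem_prodSet_extending he ⟨o, ho⟩ hx ho'
      have hT := iSup_congr fun i => congrArg (embTangent V) (hzx i)
      exact ⟨z, hz, (congrArg (fun T : Submodule ℂ (Fin D → ℂ) => Module.finrank ℂ T) hT).trans hd⟩)
  have h2 := eventually_finrank_eq _ hsub hmem hjoin (d := maxJoin V V' O O' m)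
    (fun z hz => le_csSup ⟨D, by rintro _ ⟨x, -, y, -, rfl⟩; exact hbd _⟩
      ⟨fun i => comp z (e i).castSucc, fun i => hz.1 _, _, hz.2, rfl⟩) (by
      obtain ⟨x, hx, y, hy, hd⟩ := Nat.sSup_mem (s := {d | ∃ x : Fin m → (Fin D → ℂ),
        (∀ i, x i ∈ O) ∧ ∃ y ∈ O', Module.finrank ℂ ((⨆ i, embTangent V (x i)) ⊔ embTangent V' y :
          Submodule ℂ (Fin D → ℂ)) = d})
        ⟨_, fun _ => o, fun _ => ho, o', ho', rfl⟩ ⟨D, by rintro _ ⟨x, -, y, -, rfl⟩; exact hbd _⟩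
      obtain ⟨z, hz, hzx, hzy⟩ := exists_mem_prodSet_extending he ⟨o, ho⟩ hx hy
      have hT := congrArg₂ (· ⊔ ·) (iSup_congr fun i => congrArg (embTangent V) (hzx i))
        (congrArg (embTangent V') hzy)
      exact ⟨z, hz, (congrArg (fun T : Submodule ℂ (Fin D → ℂ) => Module.finrank ℂ T) hT).trans hd⟩)
  filter_upwards [hmem, h1, h2] with z hz h1 h2
  have := Submodule.finrank_sup_add_finrank_inf_eq
    (⨆ i, embTangent V (comp z (e i).castSucc)) (embTangent V' (comp z (Fin.last n)))
  have := hN' _ hz.2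
  omega

/-- A nonzero vector lying in the generic span of `m` tangent spaces forces, by irreducibility of
the module, this span to be everything. -/
theorem Qprop_of_eventually_mem {G : Type*} [Group G]
    (ρ : G →* ((Fin D → ℂ) ≃ₗ[ℂ] (Fin D → ℂ))) (hmod : IsIrreducibleGModule ρ)
    (hVinv : ∀ (g : G), ∀ x ∈ V, ρ g x ∈ V) (hV'inv : ∀ (g : G), ∀ y ∈ V', ρ g y ∈ V')
    (hO : IsDenseOpenSubset O V) (hO' : IsDenseOpenSubset O' V') {m n : ℕ} (e : Fin m → Fin n)
    {v : Fin D → ℂ} (hv0 : v ≠ 0) (hv : ∀ᶠ z in generic (isIrreducible_factors hV hV' n),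
      v ∈ ⨆ i, embTangent V (comp z (e i).castSucc)) :
    Qprop V O m := by
  let A : Submodule ℂ (Fin D → ℂ) :=
    { carrier := {v | ∀ᶠ z in generic (isIrreducible_factors hV hV' n),
        v ∈ ⨆ i, embTangent V (comp z (e i).castSucc)}
      add_mem' := fun ha hb => by
        rw [Set.mem_ofPred_eq] at ha hb ⊢
        exact (ha.and hb).mono fun _ h => add_mem h.1 h.2
      zero_mem' := by simp
      smul_mem' := fun c _ ha => by
        rw [Set.mem_ofPred_eq] at ha ⊢
        exact ha.mono fun _ h => Submodule.smul_mem _ c h }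
  have hA : ∀ g : G, ∀ x ∈ A, ρ g x ∈ A := by
    intro g x hx
    have hinv : ∀ g : G, ∀ i, ∀ x ∈ factors V V' n i, ρ g x ∈ factors V V' n i := fun g =>
      forall_factors (p := fun _ S => ∀ x ∈ S, ρ g x ∈ S).2 ⟨fun _ => hVinv g, hV'inv g⟩
    have hsymm : (ρ g⁻¹).symm = ρ g := by
      rw [map_inv]
      rfl
    have := eventually_linearEquiv (isIrreducible_factors hV hV' n) hx (ρ g⁻¹) (hinv g⁻¹)
      (by rw [hsymm]; exact hinv g)
    refine this.mono fun z hz => ?_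
    have hmap := Submodule.mem_map_of_mem (f := (ρ g).toLinearMap) hz
    rw [Submodule.map_iSup] at hmap
    refine (iSup_mono fun i => ?_ : _ ≤ ⨆ i, embTangent V (comp z (e i).castSucc)) hmap
    refine (map_embTangent_le _ (hVinv g) _).trans (le_of_eq ?_)
    congr 1
    change ρ g (ρ g⁻¹ (comp z (e i).castSucc)) = _
    rw [map_inv]
    exact (ρ g).apply_symm_apply _
  have htop : A = ⊤ := (hmod.2 A hA).resolve_left fun h => hv0 (by
    have : v ∈ A := hv
    simpa [h] using this)
  have hall : ∀ᶠ z in generic (isIrreducible_factors hV hV' n), ∀ j : Fin D,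
      Pi.single j (1 : ℂ) ∈ ⨆ i, embTangent V (comp z (e i).castSucc) :=
    Filter.eventually_all.2 fun j => by
      have : Pi.single j (1 : ℂ) ∈ A := htop ▸ Submodule.mem_top
      exact this
  obtain ⟨z, hz, hzO⟩ := (hall.and (eventually_mem_prodSet hV hV' n hO hO')).exists
  refine ⟨fun i => comp z (e i).castSucc, fun i => hzO.1 _, ?_⟩
  rw [eq_top_iff]
  intro x _
  rw [pi_eq_sum_univ' x]
  exact sum_mem fun j _ => Submodule.smul_mem _ _ (hz j)

/-- If the generic intersection dimensions for `m` and `m + 1` tangent spaces agree and are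
positive, then `m` tangent spaces span the whole space. -/
theorem Qprop_of_finrank_inf_eq {G : Type*} [Group G]
    (ρ : G →* ((Fin D → ℂ) ≃ₗ[ℂ] (Fin D → ℂ))) (hmod : IsIrreducibleGModule ρ)
    (hVinv : ∀ (g : G), ∀ x ∈ V, ρ g x ∈ V) (hV'inv : ∀ (g : G), ∀ y ∈ V', ρ g y ∈ V')
    (hO : IsDenseOpenSubset O V) (hO' : IsDenseOpenSubset O' V') {d : ℕ → ℕ}
    (hd : ∀ (m n : ℕ) (e : Fin m → Fin n), Function.Injective e →
      ∀ᶠ z in generic (isIrreducible_factors hV hV' n),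
        Module.finrank ℂ ((⨆ i, embTangent V (comp z (e i).castSucc)) ⊓
          embTangent V' (comp z (Fin.last n)) : Submodule ℂ (Fin D → ℂ)) = d m)
    {m : ℕ} (hm : d (m + 1) = d m) (hpos : d m ≠ 0) : Qprop V O m := by
  let e (k : Fin (m + 1)) (i : Fin m) : Fin (m + m) := ⟨k + i, by omega⟩
  let e' (k : Fin m) (i : Fin (m + 1)) : Fin (m + m) := ⟨k + i, by omega⟩
  have he : ∀ k, Function.Injective (e k) := fun k i j h => by
    simpa [e, Fin.ext_iff] using h
  have he' : ∀ k, Function.Injective (e' k) := fun k i j h => by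
    simpa [e', Fin.ext_iff] using h
  have hgen := (Filter.eventually_all.2 fun k => hd m (m + m) (e k) (he k)).and
    (Filter.eventually_all.2 fun k => hd (m + 1) (m + m) (e' k) (he' k))
  have hconst : ∀ᶠ z in generic (isIrreducible_factors hV hV' (m + m)),
      (⨆ i, embTangent V (comp z (e 0 i).castSucc)) ⊓ embTangent V' (comp z (Fin.last _)) ≠ ⊥ ∧
      (⨆ i, embTangent V (comp z (e 0 i).castSucc)) ⊓ embTangent V' (comp z (Fin.last _)) =
      (⨆ i, embTangent V (comp z (e (Fin.last m) i).castSucc)) ⊓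
        embTangent V' (comp z (Fin.last _)) := by
    refine hgen.mono fun z hz => ⟨fun h => ?_, ?_⟩
    · have := hz.1 0
      rw [h, finrank_bot] at this
      exact hpos this.symm
    · suffices ∀ k : Fin (m + 1),
          (⨆ i, embTangent V (comp z (e 0 i).castSucc)) ⊓ embTangent V' (comp z (Fin.last _)) =
          (⨆ i, embTangent V (comp z (e k i).castSucc)) ⊓ embTangent V' (comp z (Fin.last _)) from
        this _
      intro k
      induction k using Fin.induction with
      | zero => rfl
      | succ k ih =>
        rw [ih]
        have hl : ∀ i, e k.castSucc i = e' k i.castSucc := fun i => rfl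
        have hr : ∀ i, e k.succ i = e' k i.succ := fun i => by
          ext
          simp only [e, e', Fin.val_succ]
          omega
        trans (⨆ i, embTangent V (comp z (e' k i).castSucc)) ⊓ embTangent V' (comp z (Fin.last _))
        · refine Submodule.eq_of_le_of_finrank_eq (inf_le_inf_right _ (iSup_le fun i => ?_))
            (((hz.1 _).trans hm.symm).trans (hz.2 k).symm)
          rw [hl]
          exact le_iSup (fun i => embTangent V (comp z (e' k i).castSucc)) i.castSucc
        · refine (Submodule.eq_of_le_of_finrank_eq (inf_le_inf_right _ (iSup_le fun i => ?_))
            (((hz.1 _).trans hm.symm).trans (hz.2 k).symm)).symm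
          rw [hr]
          exact le_iSup (fun i => embTangent V (comp z (e' k i).castSucc)) i.succ
  let s : Set (Fin (m + m + 1)) := {i | i.val < m ∨ i = Fin.last _}
  obtain ⟨w, ⟨hw, -⟩, hmix⟩ := exists_eventually_mix _ hconst s
  obtain ⟨v, hv, hv0⟩ := Submodule.exists_mem_ne_zero_of_ne_bot hw
  refine Qprop_of_eventually_mem hV hV' ρ hmod hVinv hV'inv hO hO' (e (Fin.last m)) hv0
    (hmix.mono fun z hz => ?_)
  have h0 : ∀ i, comp (mix s w z) (e 0 i).castSucc = comp w (e 0 i).castSucc := fun i =>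
    comp_mix_of_mem _ _ (Or.inl (by simp [e]))
  have h1 : ∀ i, comp (mix s w z) (e (Fin.last m) i).castSucc =
      comp z (e (Fin.last m) i).castSucc := fun i =>
    comp_mix_of_notMem _ _ (by simpa [s, e, Fin.ext_iff] using i.2.ne)
  have hlast : comp (mix s w z) (Fin.last _) = comp w (Fin.last _) :=
    comp_mix_of_mem _ _ (Or.inr rfl)
  have hz2 := hz.2
  simp only [h0, h1, hlast] at hz2
  rw [hz2] at hv
  exact hv.1

end Interval

theorem stmt_4 {D : ℕ} {G : Type*} [Group G]
    (ρ : G →* ((Fin D → ℂ) ≃ₗ[ℂ] (Fin D → ℂ)))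
    (hmod : IsIrreducibleGModule ρ)
    (V V' : Set (Fin D → ℂ))
    (hVclosed : zIsClosed V) (hVirr : zIsIrreducible V)
    (hVcone : ∀ (c : ℂ), ∀ x ∈ V, c • x ∈ V)
    (hVinv : ∀ (g : G), ∀ x ∈ V, ρ g x ∈ V)
    (hV0 : V ≠ {0})
    (hV'closed : zIsClosed V') (hV'irr : zIsIrreducible V')
    (hV'cone : ∀ (c : ℂ), ∀ y ∈ V', c • y ∈ V')
    (hV'inv : ∀ (g : G), ∀ y ∈ V', ρ g y ∈ V')
    (hV'0 : V' ≠ {0})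
    (O O' : Set (Fin D → ℂ))
    (hO : IsDenseOpenSubset O V) (hO' : IsDenseOpenSubset O' V')
    (N N' : ℕ) (hN'pos : 1 ≤ N')
    (hN : ∀ x ∈ O, Module.finrank ℂ (embTangent V x) = N)
    (hN' : ∀ y ∈ O', Module.finrank ℂ (embTangent V' y) = N') :
    { m : ℕ | ¬ Pprop V V' O O' m ∧ ¬ Qprop V O m }.Finite ∧
    { m : ℕ | ¬ Pprop V V' O O' m ∧ ¬ Qprop V O m }.ncard ≤ N' := by
  choose d hd using exists_eventually_finrank_inf hVirr hV'irr hO hO' hN hN'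
  have hmono : Monotone d := by
    refine monotone_nat_of_le_succ fun m => ?_
    obtain ⟨z, h, h'⟩ := ((hd m (m + 1) Fin.castSucc (Fin.castSucc_injective _)).and
      (hd (m + 1) (m + 1) id Function.injective_id)).exists
    have hspan : ⨆ i : Fin m, embTangent V (comp z i.castSucc.castSucc) ≤
        ⨆ i : Fin (m + 1), embTangent V (comp z (id i).castSucc) :=
      iSup_le fun i => le_iSup_of_le i.castSucc le_rfl
    rw [← h, ← h']
    exact Submodule.finrank_mono (inf_le_inf_right _ hspan)
  have hle : ∀ m, d m ≤ N' := by
    intro m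
    obtain ⟨z, h, hz⟩ := ((hd m m id Function.injective_id).and
      (eventually_mem_prodSet hVirr hV'irr m hO hO')).exists
    rw [← h]
    exact (Submodule.finrank_mono inf_le_right).trans_eq (hN' _ hz.2)
  have hpos : ∀ m, ¬ Pprop V V' O O' m → d m ≠ 0 := by
    intro m hP h0
    refine hP (Or.inr ?_)
    rw [← box_factors]
    refine box_subset_zClosure (isIrreducible_factors hVirr hV'irr m) ?_
    filter_upwards [hd m m id Function.injective_id,
      eventually_mem_prodSet hVirr hV'irr m hO hO'] with z h hz
    exact ⟨hz, Submodule.finrank_eq_zero.1 (h.trans h0)⟩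
  have hlt : ∀ m, ¬ Pprop V V' O O' m → ¬ Qprop V O m → d m < d (m + 1) := fun m hP hQ =>
    lt_of_le_of_ne (hmono m.le_succ) fun h =>
      hQ (Qprop_of_finrank_inf_eq hVirr hV'irr ρ hmod hVinv hV'inv hO hO' hd h.symm (hpos m hP))
  have hmaps : Set.MapsTo d { m : ℕ | ¬ Pprop V V' O O' m ∧ ¬ Qprop V O m } (Set.Icc 1 N') :=
    fun m hm => ⟨Nat.one_le_iff_ne_zero.2 (hpos m hm.1), hle m⟩
  have hinj : Set.InjOn d { m : ℕ | ¬ Pprop V V' O O' m ∧ ¬ Qprop V O m } := by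
    refine StrictMonoOn.injOn fun a ha b _ hab => ?_
    exact (hlt a ha.1 ha.2).trans_le (hmono hab)
  refine ⟨Set.Finite.of_injOn hmaps hinj (Set.finite_Icc _ _), ?_⟩
  simpa [Set.ncard_eq_toFinset_card'] using
    Set.ncard_le_ncard_of_injOn d hmaps hinj (Set.finite_Icc _ _)
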